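/- Let Γ be a finite graph and L a corneration of Γ. The orbits of the predecessor permutation on darts, projected to edges, give a partition C(L) of the edge set of Γ into edge sets of circuits (closed walks using each of their edges exactly once). Conversely, for any circuit decomposition C of Γ, the set L(C) of all corners {e, v, e'} with e, v, e' consecutive in some circuit of C is a corneration, and C(L(C)) = C. -/

import Mathlib

/-- A dart of a graph: a pair `(e, v)` with `v` an endpoint of the edge `e`. -/
def GraphDart {V E : Type} (bd : E → Sym2 V) : Type := {p : E × V // p.2 ∈ bd p.1}

/-- `L` is a corneration: a set of corners (a vertex together with an unordered pair
of distinct edges incident to it) such that every dart lies in exactly one corner. -/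
def IsCorneration {V E : Type} (bd : E → Sym2 V) (L : Set (V × Sym2 E)) : Prop :=
  (∀ c ∈ L, ¬ c.2.IsDiag ∧ ∀ e ∈ c.2, c.1 ∈ bd e) ∧
  ∀ (e : E) (v : V), v ∈ bd e → ∃! c : V × Sym2 E, c ∈ L ∧ c.1 = v ∧ e ∈ c.2

/-- `pred` is the predecessor permutation of the corneration `L`: it sends a dart
`(e, v)` to `(e', v')` where `{e, v, e'}` is the corner of `L` containing `(e, v)`
and `v'` is the endpoint of `e'` other than `v`. -/
def IsPredMap {V E : Type} (bd : E → Sym2 V) (L : Set (V × Sym2 E))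
    (pred : Equiv.Perm (GraphDart bd)) : Prop :=
  ∀ d : GraphDart bd, ∃ c ∈ L,
    c.1 = d.val.2 ∧ d.val.1 ∈ c.2 ∧ (pred d).val.1 ∈ c.2 ∧
    (pred d).val.1 ≠ d.val.1 ∧ (pred d).val.2 ≠ d.val.2

/-- `S ⊆ E` is the edge set of a circuit: a closed walk through pairwise distinct
edges. -/
def IsCircuitEdgeSet {V E : Type} (bd : E → Sym2 V) (S : Set E) : Prop :=
  ∃ (n : ℕ), 0 < n ∧ ∃ (v : ZMod n → V) (e : ZMod n → E),
    Function.Injective e ∧ (∀ i : ZMod n, bd (e i) = s(v i, v (i + 1))) ∧ S = Set.range e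

/-- The edge sets of the orbits of the predecessor permutation on darts. -/
def predOrbitEdgeSets {V E : Type} (bd : E → Sym2 V)
    (pred : Equiv.Perm (GraphDart bd)) : Set (Set E) :=
  {S | ∃ d : GraphDart bd, S = {e | ∃ k : ℤ, ((pred ^ k) d).val.1 = e}}

theorem GraphDart.ext' {V E : Type} {bd : E → Sym2 V} {d d' : GraphDart bd}
    (h1 : d.val.1 = d'.val.1) (h2 : d.val.2 = d'.val.2) : d = d' :=
  Subtype.ext (Prod.ext h1 h2)

/-- The dart on the same edge at the other endpoint. -/
noncomputable def dartFlip {V E : Type} {bd : E → Sym2 V} (d : GraphDart bd) : GraphDart bd :=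
  ⟨(d.val.1, Sym2.Mem.other d.property), Sym2.other_mem d.property⟩

theorem dartFlip_fst {V E : Type} {bd : E → Sym2 V} (d : GraphDart bd) :
    (dartFlip d).val.1 = d.val.1 := rfl

theorem dart_bd {V E : Type} {bd : E → Sym2 V} (d : GraphDart bd) :
    bd d.val.1 = s(d.val.2, (dartFlip d).val.2) := (Sym2.other_spec d.property).symm

theorem dartFlip_snd_ne {V E : Type} {bd : E → Sym2 V} (hnl : ∀ e : E, ¬ (bd e).IsDiag)
    (d : GraphDart bd) : (dartFlip d).val.2 ≠ d.val.2 :=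
  Sym2.other_ne (hnl _) d.property

theorem dart_eq_flip {V E : Type} {bd : E → Sym2 V}
    {d d' : GraphDart bd} (h : d'.val.1 = d.val.1) (h2 : d'.val.2 ≠ d.val.2) :
    d' = dartFlip d := by
  have h3 := d'.property
  rw [h, dart_bd d, Sym2.mem_iff] at h3
  exact GraphDart.ext' h (h3.resolve_left h2)

theorem dartFlip_flip {V E : Type} {bd : E → Sym2 V} (hnl : ∀ e : E, ¬ (bd e).IsDiag)
    (d : GraphDart bd) : dartFlip (dartFlip d) = d :=
  (dart_eq_flip (d := dartFlip d) (d' := d) rfl (dartFlip_snd_ne hnl d).symm).symm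

theorem dart_eq_or {V E : Type} {bd : E → Sym2 V}
    {d d' : GraphDart bd} (h : d'.val.1 = d.val.1) : d' = d ∨ d' = dartFlip d := by
  by_cases h2 : d'.val.2 = d.val.2
  · exact Or.inl (GraphDart.ext' h h2)
  · exact Or.inr (dart_eq_flip h h2)

theorem pred_fst_mem {V E : Type} {bd : E → Sym2 V}
    {L : Set (V × Sym2 E)} (hL : IsCorneration bd L) {p : Equiv.Perm (GraphDart bd)}
    (hp : IsPredMap bd L p) (d : GraphDart bd) :
    d.val.2 = (dartFlip (p d)).val.2 := by
  obtain ⟨c, hc, h1, h2, h3, h4, h5⟩ := hp d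
  have h6 := (hL.1 c hc).2 _ h3
  rw [h1, dart_bd (p d), Sym2.mem_iff] at h6
  exact h6.resolve_left h5.symm

theorem pred_flip_pred {V E : Type} {bd : E → Sym2 V}
    {L : Set (V × Sym2 E)} (hL : IsCorneration bd L) {p : Equiv.Perm (GraphDart bd)}
    (hp : IsPredMap bd L p) (d : GraphDart bd) :
    p (dartFlip (p d)) = dartFlip d := by
  have hv := pred_fst_mem hL hp d
  obtain ⟨c, hc, h1, h2, h3, h4, h5⟩ := hp d
  obtain ⟨c', hc', h1', h2', h3', h4', h5'⟩ := hp (dartFlip (p d))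
  have hcc : c' = c := (hL.2 _ _ (dartFlip (p d)).property).unique ⟨hc', h1', h2'⟩
    ⟨hc, h1.trans hv, h3⟩
  subst hcc
  have hs := (Sym2.mem_and_mem_iff h4).1 ⟨h3, h2⟩
  rw [hs, Sym2.mem_iff] at h3'
  refine dart_eq_flip (h3'.resolve_left h4') ?_
  rw [hv]; exact h5'

/-- The reversal permutation. -/
noncomputable def flipPerm {V E : Type} {bd : E → Sym2 V} (hnl : ∀ e : E, ¬ (bd e).IsDiag) :
    Equiv.Perm (GraphDart bd) := Function.Involutive.toPerm dartFlip (dartFlip_flip hnl)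

theorem flip_zpow {V E : Type} {bd : E → Sym2 V} (hnl : ∀ e : E, ¬ (bd e).IsDiag)
    {L : Set (V × Sym2 E)} (hL : IsCorneration bd L) {p : Equiv.Perm (GraphDart bd)}
    (hp : IsPredMap bd L p) (k : ℤ) (d : GraphDart bd) :
    dartFlip ((p ^ k) d) = (p ^ (-k)) (dartFlip d) := by
  have h : SemiconjBy (flipPerm hnl) p p⁻¹ := by
    ext1 d
    change dartFlip (p d) = p⁻¹ (dartFlip d)
    rw [Equiv.Perm.eq_inv_iff_eq]
    exact pred_flip_pred hL hp d
  have h2 := h.zpow_right k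
  rw [inv_zpow'] at h2
  exact DFunLike.congr_fun h2.eq d

theorem flip_ne_zpow {V E : Type} {bd : E → Sym2 V} (hnl : ∀ e : E, ¬ (bd e).IsDiag)
    {L : Set (V × Sym2 E)} (hL : IsCorneration bd L) {p : Equiv.Perm (GraphDart bd)}
    (hp : IsPredMap bd L p) (k : ℤ) (d : GraphDart bd) :
    (p ^ k) d ≠ dartFlip d := by
  intro h
  rcases Int.even_or_odd' k with ⟨m, rfl | rfl⟩
  · have h1 := flip_zpow hnl hL hp m d
    rw [← h, ← Equiv.Perm.mul_apply, ← zpow_add] at h1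
    have h2 : -m + 2 * m = m := by ring
    rw [h2] at h1
    exact dartFlip_snd_ne hnl _ (congrArg (fun x => x.val.2) h1)
  · have h1 := flip_zpow hnl hL hp m d
    rw [← h, ← Equiv.Perm.mul_apply, ← zpow_add] at h1
    have h2 : -m + (2 * m + 1) = 1 + m := by ring
    rw [h2, zpow_add, Equiv.Perm.mul_apply, zpow_one] at h1
    obtain ⟨c, hc, h1', h2', h3', h4', h5'⟩ := hp ((p ^ m) d)
    exact h4' (congrArg (fun x => x.val.1) h1).symm

/-- The edges of the orbit of `d`. -/
def orbitEdges {V E : Type} {bd : E → Sym2 V} (p : Equiv.Perm (GraphDart bd))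
    (d : GraphDart bd) : Set E := {e | ∃ k : ℤ, ((p ^ k) d).val.1 = e}

theorem orbitEdges_zpow {V E : Type} {bd : E → Sym2 V} (p : Equiv.Perm (GraphDart bd))
    (d : GraphDart bd) (m : ℤ) : orbitEdges p ((p ^ m) d) = orbitEdges p d := by
  ext e
  constructor
  · rintro ⟨k, hk⟩
    exact ⟨k + m, by rw [zpow_add]; exact hk⟩
  · rintro ⟨k, hk⟩
    refine ⟨k - m, ?_⟩
    rw [← Equiv.Perm.mul_apply, ← zpow_add, sub_add_cancel]; exact hk

theorem orbitEdges_flip {V E : Type} {bd : E → Sym2 V} (hnl : ∀ e : E, ¬ (bd e).IsDiag)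
    {L : Set (V × Sym2 E)} (hL : IsCorneration bd L) {p : Equiv.Perm (GraphDart bd)}
    (hp : IsPredMap bd L p) (d : GraphDart bd) :
    orbitEdges p (dartFlip d) = orbitEdges p d := by
  ext e
  constructor
  · rintro ⟨k, hk⟩
    refine ⟨-k, ?_⟩
    rw [← dartFlip_fst, flip_zpow hnl hL hp, neg_neg]; exact hk
  · rintro ⟨k, hk⟩
    refine ⟨-k, ?_⟩
    rw [← flip_zpow hnl hL hp]; exact hk

theorem orbitEdges_same {V E : Type} {bd : E → Sym2 V} (hnl : ∀ e : E, ¬ (bd e).IsDiag)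
    {L : Set (V × Sym2 E)} (hL : IsCorneration bd L) {p : Equiv.Perm (GraphDart bd)}
    (hp : IsPredMap bd L p) {d d' : GraphDart bd} (h : d'.val.1 = d.val.1) :
    orbitEdges p d' = orbitEdges p d := by
  rcases dart_eq_or h with rfl | rfl
  · rfl
  · exact orbitEdges_flip hnl hL hp d

theorem orbitEdges_circuit {V E : Type} [Finite V] [Finite E] {bd : E → Sym2 V}
    (hnl : ∀ e : E, ¬ (bd e).IsDiag)
    {L : Set (V × Sym2 E)} (hL : IsCorneration bd L) {p : Equiv.Perm (GraphDart bd)}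
    (hp : IsPredMap bd L p) (d : GraphDart bd) :
    IsCircuitEdgeSet bd (orbitEdges p d) := by
  have : Finite (GraphDart bd) := inferInstanceAs (Finite {p : E × V // p.2 ∈ bd p.1})
  set n := Function.minimalPeriod (p • ·) d with hn
  have hper : ∀ k : ℤ, (p ^ k) d = d ↔ (n : ℤ) ∣ k := fun k =>
    MulAction.zpow_smul_eq_iff_minimalPeriod_dvd (a := p) (b := d)
  have hpos : 0 < n := by
    rcases Nat.eq_zero_or_pos n with h0 | h0
    · exfalso
      have := (hper (orderOf p)).1 (by rw [zpow_natCast, pow_orderOf_eq_one]; rfl)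
      rw [h0] at this
      have h3 := orderOf_pos p
      have h4 : ((orderOf p : ℕ) : ℤ) = 0 := Int.zero_dvd.1 (by exact_mod_cast this)
      omega
    · exact h0
  have heq : ∀ k l : ℤ, (p ^ k) d = (p ^ l) d ↔ ((k : ZMod n) = (l : ZMod n)) := by
    intro k l
    rw [eq_comm (a := (k : ZMod n)), ZMod.intCast_eq_intCast_iff_dvd_sub, ← hper, sub_eq_neg_add,
      zpow_add, Equiv.Perm.mul_apply, zpow_neg, Equiv.Perm.inv_eq_iff_eq]
  have key : ∀ k : ℤ, (p ^ ((k : ZMod n).cast : ℤ)) d = (p ^ k) d := by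
    intro k
    rw [heq]; simp
  refine ⟨n, hpos, fun i => ((p ^ ((i - 1).cast : ℤ)) d).val.2,
    fun i => ((p ^ (i.cast : ℤ)) d).val.1, ?_, ?_, ?_⟩
  · intro i j hij
    obtain ⟨k, rfl⟩ := ZMod.intCast_surjective i
    obtain ⟨l, rfl⟩ := ZMod.intCast_surjective j
    simp only [key] at hij
    rcases dart_eq_or hij with h | h
    · exact (heq _ _).1 h
    · exfalso
      apply flip_ne_zpow hnl hL hp (k - l) ((p ^ l) d)
      rw [← Equiv.Perm.mul_apply, ← zpow_add, sub_add_cancel]; exact h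
  · intro i
    obtain ⟨k, rfl⟩ := ZMod.intCast_surjective i
    have h1 : (k : ZMod n) - 1 = ((k - 1 : ℤ) : ZMod n) := by push_cast; rfl
    simp only [add_sub_cancel_right, h1, key]
    have h2 := pred_fst_mem hL hp ((p ^ (k - 1)) d)
    have h3 : p ((p ^ (k - 1)) d) = (p ^ k) d := by
      rw [← Equiv.Perm.mul_apply, ← zpow_one_add]; congr 2; ring
    rw [h3] at h2
    rw [h2, dart_bd ((p ^ k) d), Sym2.eq_swap]
  · ext e
    constructor
    · rintro ⟨k, hk⟩
      exact ⟨(k : ZMod n), by simp only [key]; exact hk⟩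
    · rintro ⟨i, hi⟩
      exact ⟨_, hi⟩

theorem circuits_corneration {V E : Type}
    (bd : E → Sym2 V) (hnl : ∀ e : E, ¬ (bd e).IsDiag)
    (ι : Type) (n : ι → ℕ)
    (vf : (i : ι) → ZMod (n i) → V) (ef : (i : ι) → ZMod (n i) → E)
    (hinj : ∀ i, Function.Injective (ef i))
    (hbd : ∀ (i : ι) (k : ZMod (n i)), bd (ef i k) = s(vf i k, vf i (k + 1)))
    (hex : ∀ e : E, ∃! p : Σ i : ι, ZMod (n i), ef p.1 p.2 = e) :
    IsCorneration bd
        {c : V × Sym2 E | ∃ (i : ι) (k : ZMod (n i)),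
          c = (vf i (k + 1), s(ef i k, ef i (k + 1)))} := by
  have hvne : ∀ i k, vf i k ≠ vf i (k + 1) := by
    intro i k h
    apply hnl (ef i k)
    rw [hbd, h]; simp
  have huniq : ∀ i k j l, ef i k = ef j l → (⟨i, k⟩ : Σ i : ι, ZMod (n i)) = ⟨j, l⟩ := by
    intro i k j l h
    exact (hex (ef j l)).unique h rfl
  refine ⟨?_, ?_⟩
  · rintro c ⟨i, k, rfl⟩
    refine ⟨?_, ?_⟩
    · intro h
      have h1 : ef i k = ef i (k + 1) := by simpa using h
      exact hvne i k (congrArg (vf i) (hinj i h1))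
    · intro e he
      rcases Sym2.mem_iff.1 he with rfl | rfl <;> rw [hbd] <;> simp
  · intro e v hv
    obtain ⟨⟨i, k⟩, hik⟩ := (hex e).exists
    change ef i k = e at hik
    subst hik
    simp only [hbd, Sym2.mem_iff] at hv
    rcases hv with rfl | rfl
    · refine ⟨(vf i (k - 1 + 1), s(ef i (k - 1), ef i (k - 1 + 1))),
        ⟨⟨i, k - 1, rfl⟩, by simp, by simp⟩, ?_⟩
      rintro c ⟨⟨j, l, rfl⟩, h1, h2⟩
      rcases Sym2.mem_iff.1 h2 with h | h
      · cases huniq _ _ _ _ h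
        exact absurd h1.symm (hvne _ _)
      · have := huniq _ _ _ _ h
        obtain ⟨rfl, h4⟩ := Sigma.mk.inj_iff.1 this
        obtain rfl := eq_of_heq h4
        simp
    · refine ⟨(vf i (k + 1), s(ef i k, ef i (k + 1))), ⟨⟨i, k, rfl⟩, by simp, by simp⟩, ?_⟩
      rintro c ⟨⟨j, l, rfl⟩, h1, h2⟩
      rcases Sym2.mem_iff.1 h2 with h | h
      · cases huniq _ _ _ _ h
        rfl
      · have := huniq _ _ _ _ h
        obtain ⟨rfl, h4⟩ := Sigma.mk.inj_iff.1 this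
        obtain rfl := eq_of_heq h4
        exact absurd h1 (hvne _ _)

/-- For a corneration `L` of a finite loopless graph, the orbits of the predecessor
permutation on darts, projected to edges, form a partition of the edge set into edge
sets of circuits.  Conversely, for any circuit decomposition `C` (a family of circuits
whose edges partition `E`), the set `L(C)` of corners consecutive in some circuit of
`C` is a corneration, and the circuit decomposition obtained from `L(C)` is `C`
itself. -/
theorem corneration_circuit_decomposition {V E : Type} [Fintype V] [Fintype E]
    (bd : E → Sym2 V) (hnl : ∀ e : E, ¬ (bd e).IsDiag) :
    (∀ (L : Set (V × Sym2 E)), IsCorneration bd L →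
      ∀ (pred : Equiv.Perm (GraphDart bd)), IsPredMap bd L pred →
        (∀ S ∈ predOrbitEdgeSets bd pred, IsCircuitEdgeSet bd S) ∧
        (∀ e : E, ∃! S : Set E, S ∈ predOrbitEdgeSets bd pred ∧ e ∈ S)) ∧
    (∀ (ι : Type) (n : ι → ℕ) (hn : ∀ i, 0 < n i)
        (vf : (i : ι) → ZMod (n i) → V) (ef : (i : ι) → ZMod (n i) → E),
      (∀ i, Function.Injective (ef i)) →
      (∀ (i : ι) (k : ZMod (n i)), bd (ef i k) = s(vf i k, vf i (k + 1))) →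
      (∀ e : E, ∃! p : Σ i : ι, ZMod (n i), ef p.1 p.2 = e) →
      IsCorneration bd
        {c : V × Sym2 E | ∃ (i : ι) (k : ZMod (n i)),
          c = (vf i (k + 1), s(ef i k, ef i (k + 1)))} ∧
      ∀ (pred : Equiv.Perm (GraphDart bd)),
        IsPredMap bd
          {c : V × Sym2 E | ∃ (i : ι) (k : ZMod (n i)),
            c = (vf i (k + 1), s(ef i k, ef i (k + 1)))} pred →
        predOrbitEdgeSets bd pred = {S : Set E | ∃ i : ι, S = Set.range (ef i)}) := by
  refine ⟨?_, ?_⟩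
  · intro L hL p hp
    refine ⟨?_, ?_⟩
    · rintro S ⟨d, rfl⟩
      exact orbitEdges_circuit hnl hL hp d
    · intro e
      obtain ⟨v, hv⟩ : ∃ v, v ∈ bd e := by
        induction h : bd e with
        | h a b => exact ⟨a, by simp⟩
      let d₀ : GraphDart bd := ⟨(e, v), hv⟩
      refine ⟨orbitEdges p d₀, ⟨⟨d₀, rfl⟩, 0, rfl⟩, ?_⟩
      rintro S ⟨⟨d, rfl⟩, k, hk⟩
      change orbitEdges p d = _
      rw [← orbitEdges_zpow p d k]
      exact orbitEdges_same hnl hL hp hk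
  · intro ι n hn vf ef hinj hbd hex
    have hL := circuits_corneration bd hnl ι n vf ef hinj hbd hex
    refine ⟨hL, ?_⟩
    intro p hp
    let F : (i : ι) → ZMod (n i) → GraphDart bd :=
      fun i k => ⟨(ef i k, vf i k), by simp only [hbd]; simp⟩
    have hF : ∀ i k, p (F i (k + 1)) = F i k := by
      intro i k
      obtain ⟨c, hc, h1, h2, h3, h4, h5⟩ := hp (F i (k + 1))
      have hcc : c = (vf i (k + 1), s(ef i k, ef i (k + 1))) :=
        (hL.2 _ _ (F i (k + 1)).property).unique ⟨hc, h1, h2⟩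
          ⟨⟨i, k, rfl⟩, rfl, Sym2.mem_mk_right _ _⟩
      subst hcc
      have h6 : (p (F i (k + 1))).val.1 = ef i k := (Sym2.mem_iff.1 h3).resolve_right h4
      have h7 := (p (F i (k + 1))).property
      rw [h6, hbd, Sym2.mem_iff] at h7
      exact GraphDart.ext' h6 (h7.resolve_right h5)
    have hFn : ∀ i (m : ℕ) k, (p ^ m) (F i (k + m)) = F i k := by
      intro i m
      induction m with
      | zero => intro k; simp
      | succ m ih =>
        intro k
        rw [pow_succ, Equiv.Perm.mul_apply]
        rw [Nat.cast_succ, ← add_assoc, hF, ih]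
    have hFz : ∀ i (m : ℤ) k, (p ^ m) (F i k) = F i (k - m) := by
      intro i m k
      obtain ⟨m, rfl | rfl⟩ := m.eq_nat_or_neg
      · have := hFn i m (k - m)
        rw [sub_add_cancel] at this
        rw [zpow_natCast, this]; simp
      · rw [zpow_neg, Equiv.Perm.inv_eq_iff_eq, zpow_natCast]
        have := hFn i m k
        rw [← this]; simp
    have hFo : ∀ i k, orbitEdges p (F i k) = Set.range (ef i) := by
      intro i k
      ext e
      constructor
      · rintro ⟨m, rfl⟩
        exact ⟨k - m, by rw [hFz]⟩
      · rintro ⟨l, rfl⟩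
        obtain ⟨m, hm⟩ := ZMod.intCast_surjective (k - l)
        refine ⟨m, ?_⟩
        rw [hFz, hm, sub_sub_cancel]
    ext S
    constructor
    · rintro ⟨d, rfl⟩
      obtain ⟨⟨i, k⟩, hk⟩ := (hex d.val.1).exists
      refine ⟨i, ?_⟩
      rw [← hFo i k]
      exact orbitEdges_same hnl hL hp hk.symm
    · rintro ⟨i, rfl⟩
      exact ⟨F i 0, (hFo i 0).symm⟩
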